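/- (Theorem 3.1, exponential expressivity: deviation propagation under the linearized covariance dynamics.) Let N ≥ 2 be even, K an integer with 1 ≤ K ≤ N/2 + 1, and χ_{q*}, χ_κ, χ_{c*} real parameters with χ_κ ≠ 0. Define J : ℝ^{N×N} → ℝ^{N×N} by [J(E)]_{α,α'} := (1/N²) ∑_{k'=0}^{K−1} c_{k'} cos(θ^{(k')}_{α,α'}) ∑_{β=0}^{N−1} ∑_{β'=0}^{N−1} cos(θ^{(k')}_{β,β'}) ( [β = β'] (χ_{q*} − χ_κ + [k' = 0] N χ_κ) + [β ≠ β'] χ_{c*} ) E_{β,β'}. For k ∈ {1, …, K−1} let ψ^{(k)}_{β,β'} := cos(θ^{(k)}_{β,β'}) − (∑_{s=0}^{K−1} c_s)^{−1} ∑_{s=0}^{K−1} c_s cos(θ^{(s)}_{β,β'}); let ψ_{β,β'} := 1 − (1/N) ((χ_κ + χ_{c*} − χ_{q*})/χ_κ) ∑_{s=0}^{K−1} c_s cos(θ^{(s)}_{β,β'}); and let χ := (1/N)(∑_{s=0}^{K−1} c_s) χ_{q*} + (1 − (1/N) ∑_{s=0}^{K−1} c_s)(χ_κ + χ_{c*}).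 Suppose E^{(0)} = ε ψ + ∑_{k=1}^{K−1} ε_k ψ^{(k)} + e with real scalars ε, ε_1, …, ε_{K−1} and e ∈ ℝ^{N×N} satisfying J(e) = 0. Then for every integer ℓ ≥ 1, the ℓ-fold iterate satisfies J^{∘ℓ}(E^{(0)}) = χ^ℓ ε ψ + ∑_{k=1}^{K−1} χ_{c*}^ℓ ε_k ψ^{(k)}. -/

import Mathlib

open Real Finset

/-- `c_k = 2 - [k = 0] - [k = N/2]`. -/
noncomputable def cConst (N k : ℕ) : ℝ := if k = 0 ∨ k = N / 2 then 1 else 2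

/-- `θ^{(k)}_{α,α'} = (2πk/N)(α - α')`. -/
noncomputable def θConst (N : ℕ) (k : ℕ) (α α' : Fin N) : ℝ :=
  2 * π * (k : ℝ) / (N : ℝ) * ((α : ℝ) - (α' : ℝ))

/-- The linearized covariance map `J` of the simplified FNO at the fixed point:
`[J(E)]_{α,α'} = (1/N²) ∑_{k'<K} c_{k'} cos(θ^{(k')}_{α,α'}) ∑_{β,β'} cos(θ^{(k')}_{β,β'})
  ([β=β'](χ_{q*} - χ_κ + [k'=0] N χ_κ) + [β≠β'] χ_{c*}) E_{β,β'}`. -/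
noncomputable def Jmap (N K : ℕ) (χq χκ χc : ℝ)
    (E : Matrix (Fin N) (Fin N) ℝ) : Matrix (Fin N) (Fin N) ℝ :=
  Matrix.of fun α α' =>
    (1 / (N : ℝ) ^ 2) * ∑ k' ∈ Finset.range K, cConst N k' * Real.cos (θConst N k' α α') *
      ∑ β : Fin N, ∑ β' : Fin N, Real.cos (θConst N k' β β') *
        ((if β = β' then χq - χκ + (if k' = 0 then (N : ℝ) * χκ else 0) else χc) * E β β')

/-- The periodic eigenmatrix `ψ^{(k)}` of the linearized covariance map. -/
noncomputable def ψper (N K k : ℕ) : Matrix (Fin N) (Fin N) ℝ :=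
  Matrix.of fun β β' => Real.cos (θConst N k β β') -
    (∑ s ∈ Finset.range K, cConst N s)⁻¹ *
      ∑ s ∈ Finset.range K, cConst N s * Real.cos (θConst N s β β')

/-- The zero-frequency eigenmatrix `ψ` of the linearized covariance map. -/
noncomputable def ψzero (N K : ℕ) (χq χκ χc : ℝ) : Matrix (Fin N) (Fin N) ℝ :=
  Matrix.of fun β β' => 1 - (1 / (N : ℝ)) * ((χκ + χc - χq) / χκ) *
    ∑ s ∈ Finset.range K, cConst N s * Real.cos (θConst N s β β')

lemma sumcos (N : ℕ) (hN : 2 ≤ N) (m : ℤ) :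
    ∑ β : Fin N, ∑ β' : Fin N, Real.cos (2 * π * (m : ℝ) / (N : ℝ) * ((β : ℝ) - (β' : ℝ))) =
      if (N : ℤ) ∣ m then (N : ℝ) ^ 2 else 0 := by
  have hN0 : (N : ℝ) ≠ 0 := by positivity
  have hNC : (N : ℂ) ≠ 0 := by exact_mod_cast hN0
  split_ifs with h
  · obtain ⟨j, rfl⟩ := h
    have : ∀ β β' : Fin N, Real.cos (2 * π * (((N : ℤ) * j : ℤ) : ℝ) / (N : ℝ) * ((β : ℝ) - (β' : ℝ))) = 1 := by
      intro β β'
      rw [Real.cos_eq_one_iff]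
      refine ⟨j * ((β : ℤ) - (β' : ℤ)), ?_⟩
      push_cast
      field_simp
    simp only [this]
    simp [sq]
  · set x : ℝ := 2 * π * (m : ℝ) / (N : ℝ) with hx
    set z : ℂ := Complex.exp (x * Complex.I) with hz
    have hzN : z ^ N = 1 := by
      rw [hz, ← Complex.exp_nat_mul, Complex.exp_eq_one_iff]
      refine ⟨m, ?_⟩
      rw [hx]; push_cast; field_simp
    have hz1 : z ≠ 1 := by
      intro hh
      rw [hz, Complex.exp_eq_one_iff] at hh
      obtain ⟨n, hn⟩ := hh
      apply h
      refine ⟨n, ?_⟩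
      have h2 : (m : ℂ) = N * n := by
        rw [hx] at hn; push_cast at hn
        have hpi : (2 * π * Complex.I : ℂ) ≠ 0 := by simp [Real.pi_ne_zero]
        field_simp at hn
        have hpi' : (π : ℂ) ≠ 0 := by simp [Real.pi_ne_zero]
        first | linear_combination hn | (apply mul_left_cancel₀ hpi'; linear_combination hn)
      exact_mod_cast h2
    have hg : ∑ β : Fin N, z ^ (β : ℕ) = 0 := by
      rw [Fin.sum_univ_eq_sum_range (fun i => z ^ i), geom_sum_eq hz1, hzN]; simp
    have hpow : ∀ n : ℕ, z ^ n = (Real.cos (x * n) : ℂ) + (Real.sin (x * n) : ℂ) * Complex.I := by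
      intro n
      rw [hz, ← Complex.exp_nat_mul, Complex.ofReal_cos, Complex.ofReal_sin, ← Complex.exp_mul_I]
      congr 1; push_cast; ring
    have hc : ∑ β : Fin N, Real.cos (x * (β : ℕ)) = 0 := by
      have := congrArg Complex.re hg
      simpa [hpow, -Complex.ofReal_cos, -Complex.ofReal_sin, Complex.re_sum] using this
    have hs : ∑ β : Fin N, Real.sin (x * (β : ℕ)) = 0 := by
      have := congrArg Complex.im hg
      simpa [hpow, -Complex.ofReal_cos, -Complex.ofReal_sin, Complex.im_sum] using this
    simp only [mul_sub, Real.cos_sub, Finset.sum_add_distrib, ← Finset.mul_sum, hc, hs]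
    simp

lemma orth (N : ℕ) (hN : 2 ≤ N) (he : Even N) (k s : ℕ) (hk : k ≤ N / 2) (hs : s ≤ N / 2) :
    cConst N k * ∑ β : Fin N, ∑ β' : Fin N,
      Real.cos (θConst N k β β') * Real.cos (θConst N s β β') =
      if k = s then (N : ℝ) ^ 2 else 0 := by
  have h1 : ∑ β : Fin N, ∑ β' : Fin N,
      Real.cos (θConst N k β β') * Real.cos (θConst N s β β') =
      ((if (N : ℤ) ∣ ((k : ℤ) - s) then (N : ℝ) ^ 2 else 0) +
        (if (N : ℤ) ∣ ((k : ℤ) + s) then (N : ℝ) ^ 2 else 0)) / 2 := by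
    rw [← sumcos N hN, ← sumcos N hN, ← Finset.sum_add_distrib, Finset.sum_div]
    refine Finset.sum_congr rfl fun β _ => ?_
    rw [← Finset.sum_add_distrib, Finset.sum_div]
    refine Finset.sum_congr rfl fun β' _ => ?_
    have e1 : 2 * π * (((k : ℤ) - s : ℤ) : ℝ) / (N : ℝ) * ((β : ℝ) - (β' : ℝ)) =
        θConst N k β β' - θConst N s β β' := by
      unfold θConst; push_cast; ring
    have e2 : 2 * π * (((k : ℤ) + s : ℤ) : ℝ) / (N : ℝ) * ((β : ℝ) - (β' : ℝ)) =
        θConst N k β β' + θConst N s β β' := by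
      unfold θConst; push_cast; ring
    rw [e1, e2, Real.cos_sub, Real.cos_add]; ring
  obtain ⟨M, rfl⟩ := he
  have hM : (M + M) / 2 = M := by omega
  rw [hM] at hk hs
  rw [h1]
  have d1 : ((M + M : ℕ) : ℤ) ∣ ((k : ℤ) - s) ↔ k = s := by
    constructor
    · intro h
      by_contra hne
      have := Int.le_of_dvd (a := ((M + M : ℕ) : ℤ)) (b := |(k : ℤ) - s|) (by
        apply abs_pos.2; omega) ((dvd_abs _ _).2 h)
      have h3 : |(k : ℤ) - s| ≤ M := by rw [abs_le]; constructor <;> omega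
      omega
    · rintro rfl; simp
  have d2 : ((M + M : ℕ) : ℤ) ∣ ((k : ℤ) + s) ↔ (k = s ∧ (k = 0 ∨ k = M)) := by
    constructor
    · intro h
      by_cases h0 : (k : ℤ) + s = 0
      · omega
      · have := Int.le_of_dvd (by omega) h
        omega
    · rintro ⟨rfl, rfl | rfl⟩ <;> simp
  simp only [d1, d2]
  unfold cConst
  rw [hM]
  by_cases h : k = s
  · by_cases h' : k = 0 ∨ k = M
    · simp only [h, true_and, if_true] at h' ⊢; simp [h']
    · simp only [h, true_and, if_true] at h' ⊢; simp [h']; ring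
  · simp [h]

lemma J_add (N K : ℕ) (χq χκ χc : ℝ) (A B : Matrix (Fin N) (Fin N) ℝ) :
    Jmap N K χq χκ χc (A + B) = Jmap N K χq χκ χc A + Jmap N K χq χκ χc B := by
  ext α α'
  simp only [Jmap, Matrix.of_apply, Matrix.add_apply, mul_add, Finset.sum_add_distrib]

lemma J_smul (N K : ℕ) (χq χκ χc r : ℝ) (A : Matrix (Fin N) (Fin N) ℝ) :
    Jmap N K χq χκ χc (r • A) = r • Jmap N K χq χκ χc A := by
  ext α α'
  simp only [Jmap, Matrix.of_apply, Matrix.smul_apply, smul_eq_mul, Finset.mul_sum]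
  refine Finset.sum_congr rfl fun _ _ => Finset.sum_congr rfl fun _ _ =>
    Finset.sum_congr rfl fun _ _ => by ring

/-- `J` as a linear map. -/
noncomputable def Jlin (N K : ℕ) (χq χκ χc : ℝ) :
    Matrix (Fin N) (Fin N) ℝ →ₗ[ℝ] Matrix (Fin N) (Fin N) ℝ where
  toFun := Jmap N K χq χκ χc
  map_add' := J_add N K χq χκ χc
  map_smul' := J_smul N K χq χκ χc

/-- cosine matrix -/
noncomputable def Cm (N s : ℕ) : Matrix (Fin N) (Fin N) ℝ :=
  Matrix.of fun β β' => Real.cos (θConst N s β β')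

/-- weighted sum of cosine matrices -/
noncomputable def Dm (N K : ℕ) : Matrix (Fin N) (Fin N) ℝ :=
  ∑ s ∈ Finset.range K, cConst N s • Cm N s

lemma Dm_apply (N K : ℕ) (β β' : Fin N) :
    Dm N K β β' = ∑ s ∈ Finset.range K, cConst N s * Real.cos (θConst N s β β') := by
  simp [Dm, Cm, Matrix.sum_apply]

lemma J_C (N K : ℕ) (hN : 2 ≤ N) (hNe : Even N) (hK : K ≤ N / 2 + 1) (χq χκ χc : ℝ)
    (s : ℕ) (hs : s < K) :
    Jlin N K χq χκ χc (Cm N s) =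
      χc • Cm N s + ((χq - χκ - χc) / N) • Dm N K + χκ • Cm N 0 := by
  have hN0 : (N : ℝ) ≠ 0 := by positivity
  have key : ∀ k ∈ Finset.range K, cConst N k * (∑ β : Fin N, ∑ β' : Fin N,
      Real.cos (θConst N k β β') *
        ((if β = β' then χq - χκ + (if k = 0 then (N : ℝ) * χκ else 0) else χc) * Cm N s β β'))
      = χc * (if k = s then (N : ℝ) ^ 2 else 0) +
        cConst N k * (N * (χq - χκ - χc)) + (if k = 0 then (N : ℝ) ^ 2 * χκ else 0) := by
    intro k hk
    rw [Finset.mem_range] at hk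
    rw [← orth N hN hNe k s (by omega) (by omega)]
    have : ∀ β β' : Fin N, Real.cos (θConst N k β β') *
        ((if β = β' then χq - χκ + (if k = 0 then (N : ℝ) * χκ else 0) else χc) * Cm N s β β')
        = χc * (Real.cos (θConst N k β β') * Real.cos (θConst N s β β')) +
          (if β = β' then χq - χκ - χc + (if k = 0 then (N : ℝ) * χκ else 0) else 0) := by
      intro β β'
      by_cases h : β = β'
      · subst h; simp [Cm, θConst]; ring
      · simp [Cm, h]; ring
    simp only [this, Finset.sum_add_distrib, ← Finset.mul_sum]
    by_cases h0 : k = 0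
    · subst h0; simp [cConst]; ring
    · simp [h0]; ring
  ext α α'
  change (1 / (N : ℝ) ^ 2) * ∑ k' ∈ Finset.range K, cConst N k' * Real.cos (θConst N k' α α') * _ = _
  have h2 := fun k hk => congrArg (Real.cos (θConst N k α α') * ·) (key k hk)
  simp only [← mul_assoc] at h2
  have h3 : ∀ k, Real.cos (θConst N k α α') * cConst N k = cConst N k * Real.cos (θConst N k α α') :=
    fun k => mul_comm _ _
  simp only [h3] at h2
  simp only [← mul_assoc]
  rw [Finset.sum_congr rfl h2]
  simp only [Matrix.add_apply, Matrix.smul_apply, smul_eq_mul, Dm_apply]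
  have h4 : ∀ k ∈ Finset.range K, Real.cos (θConst N k α α') * (χc * (if k = s then (N : ℝ) ^ 2 else 0) +
        cConst N k * (N * (χq - χκ - χc)) + (if k = 0 then (N : ℝ) ^ 2 * χκ else 0)) =
      (if k = s then χc * (N : ℝ) ^ 2 * Real.cos (θConst N s α α') else 0) +
      N * (χq - χκ - χc) * (cConst N k * Real.cos (θConst N k α α')) +
      (if k = 0 then (N : ℝ) ^ 2 * χκ * Real.cos (θConst N 0 α α') else 0) := by
    intro k _
    by_cases h : k = s <;> by_cases h' : k = 0
    · subst h; subst h'; simp; ring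
    · subst h; simp [h']; ring
    · subst h'; simp [h]; ring
    · simp [h, h']; ring
  simp only [← mul_assoc] at h4
  rw [Finset.sum_congr rfl h4]
  simp only [Finset.sum_add_distrib, Finset.sum_ite_eq', Finset.mem_range, hs,
    (by omega : 0 < K), if_true, Cm, Matrix.of_apply, mul_assoc, ← Finset.mul_sum]
  field_simp

lemma J_D (N K : ℕ) (hN : 2 ≤ N) (hNe : Even N) (hK : K ≤ N / 2 + 1) (χq χκ χc : ℝ) :
    Jlin N K χq χκ χc (Dm N K) = χc • Dm N K + (∑ s ∈ Finset.range K, cConst N s) •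
      (((χq - χκ - χc) / N) • Dm N K + χκ • Cm N 0) := by
  conv_lhs => rw [Dm]
  rw [map_sum, Finset.sum_smul]
  conv_rhs => arg 1; rw [Dm]
  rw [Finset.smul_sum, ← Finset.sum_add_distrib]
  refine Finset.sum_congr rfl fun s hs => ?_
  rw [map_smul, J_C N K hN hNe hK _ _ _ s (Finset.mem_range.1 hs)]
  module

lemma S_pos (N K : ℕ) (hK1 : 1 ≤ K) : 0 < ∑ s ∈ Finset.range K, cConst N s := by
  apply Finset.sum_pos
  · intro i _; unfold cConst; split_ifs <;> norm_num
  · exact ⟨0, by simp; omega⟩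

lemma J_per (N K : ℕ) (hN : 2 ≤ N) (hNe : Even N) (hK : K ≤ N / 2 + 1) (χq χκ χc : ℝ)
    (k : ℕ) (hk : k < K) :
    Jlin N K χq χκ χc (ψper N K k) = χc • ψper N K k := by
  have h : ψper N K k = Cm N k - (∑ s ∈ Finset.range K, cConst N s)⁻¹ • Dm N K := by
    ext; simp [ψper, Dm_apply, Cm]
  have hS := (S_pos N K (by omega)).ne'
  rw [h, map_sub, map_smul, J_C N K hN hNe hK _ _ _ k hk, J_D N K hN hNe hK, smul_add,
    inv_smul_smul₀ hS]
  module

lemma J_zero (N K : ℕ) (hN : 2 ≤ N) (hNe : Even N) (hK1 : 1 ≤ K) (hK : K ≤ N / 2 + 1)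
    (χq χκ χc : ℝ) (hκ : χκ ≠ 0) :
    Jlin N K χq χκ χc (ψzero N K χq χκ χc) =
      ((1 / (N : ℝ)) * (∑ s ∈ Finset.range K, cConst N s) * χq +
      (1 - (1 / (N : ℝ)) * ∑ s ∈ Finset.range K, cConst N s) * (χκ + χc)) •
        ψzero N K χq χκ χc := by
  have hN0 : (N : ℝ) ≠ 0 := by positivity
  have h : ψzero N K χq χκ χc = Cm N 0 - ((1 / (N : ℝ)) * ((χκ + χc - χq) / χκ)) • Dm N K := by
    ext; simp [ψzero, Dm_apply, Cm, θConst]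
  rw [h, map_sub, map_smul, J_C N K hN hNe hK _ _ _ 0 (by omega), J_D N K hN hNe hK]
  match_scalars <;> field_simp <;> ring

/-- Theorem 3.1 (exponential expressivity): deviation propagation under the linearized
covariance dynamics: if `E⁽⁰⁾ = ε ψ + ∑_{k=1}^{K-1} ε_k ψ^{(k)} + e` with `J(e) = 0`,
then `J^{∘ℓ}(E⁽⁰⁾) = χ^ℓ ε ψ + ∑_{k=1}^{K-1} χ_{c*}^ℓ ε_k ψ^{(k)}` for all `ℓ ≥ 1`. -/
theorem stmt11 (N K : ℕ) (hN : 2 ≤ N) (hNeven : Even N) (hK1 : 1 ≤ K)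
    (hK : K ≤ N / 2 + 1) (χq χκ χc : ℝ) (hκ : χκ ≠ 0)
    (ε : ℝ) (εk : ℕ → ℝ) (e : Matrix (Fin N) (Fin N) ℝ)
    (he : Jmap N K χq χκ χc e = 0)
    (E₀ : Matrix (Fin N) (Fin N) ℝ)
    (hE₀ : E₀ = ε • ψzero N K χq χκ χc +
      (∑ k ∈ Finset.Ico 1 K, εk k • ψper N K k) + e)
    (χ : ℝ)
    (hχ : χ = (1 / (N : ℝ)) * (∑ s ∈ Finset.range K, cConst N s) * χq +
      (1 - (1 / (N : ℝ)) * ∑ s ∈ Finset.range K, cConst N s) * (χκ + χc))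
    (ℓ : ℕ) (hℓ : 1 ≤ ℓ) :
    (Jmap N K χq χκ χc)^[ℓ] E₀ =
      (χ ^ ℓ * ε) • ψzero N K χq χκ χc +
        ∑ k ∈ Finset.Ico 1 K, (χc ^ ℓ * εk k) • ψper N K k := by
  subst hE₀
  have hz := J_zero N K hN hNeven hK1 hK χq χκ χc hκ
  rw [← hχ] at hz
  have hstep : ∀ (a : ℝ) (b : ℕ → ℝ), Jlin N K χq χκ χc (a • ψzero N K χq χκ χc +
      ∑ k ∈ Finset.Ico 1 K, b k • ψper N K k) = (χ * a) • ψzero N K χq χκ χc +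
      ∑ k ∈ Finset.Ico 1 K, (χc * b k) • ψper N K k := by
    intro a b
    rw [map_add, map_smul, hz, map_sum, smul_smul, mul_comm a]
    congr 1
    refine Finset.sum_congr rfl fun k hk => ?_
    rw [map_smul, J_per N K hN hNeven hK _ _ _ k (Finset.mem_Ico.1 hk).2, smul_smul,
      mul_comm (b k)]
  have he' : Jlin N K χq χκ χc e = 0 := he
  change (Jlin N K χq χκ χc)^[ℓ] _ = _
  induction ℓ, hℓ using Nat.le_induction with
  | base =>
    rw [Function.iterate_one, map_add, he', add_zero, hstep]
    simp
  | succ n hn ih =>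
    rw [Function.iterate_succ_apply', ih, hstep]
    simp only [pow_succ', mul_assoc]
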